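/- In ℂ³ with the standard inner product, if v : P → {0,1} is a function on rank-1 projections such that for every triple p₁, p₂, p₃ of mutually orthogonal rank-1 projections exactly one pᵢ has v(pᵢ) = 1, then v cannot be extended consistently, i.e., no such total function exists on all rank-1 projections of ℂ³ (Kochen–Specker theorem in dimension 3). -/

import Mathlib

open scoped Matrix

/-- The orthogonal projections onto the lines spanned by an orthogonal basis sum to the identity. -/
theorem sum_starProjection_span_singleton_eq_one {𝕜 E ι : Type*} [RCLike 𝕜]
    [NormedAddCommGroup E] [InnerProductSpace 𝕜 E] [Fintype ι] [Nonempty ι]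
    {v : ι → E} (hv : ∀ i, v i ≠ 0) (ho : Pairwise fun i j => inner 𝕜 (v i) (v j) = 0)
    (hcard : Fintype.card ι = Module.finrank 𝕜 E) :
    ∑ i, (𝕜 ∙ v i).starProjection = (1 : E →L[𝕜] E) := by
  have hspan : Submodule.span 𝕜 (Set.range v) = ⊤ :=
    (linearIndependent_of_ne_zero_of_inner_eq_zero hv ho).span_eq_top_of_card_eq_finrank hcard
  refine ContinuousLinearMap.coe_injective (LinearMap.ext_on_range hspan fun j => ?_)
  simp only [ContinuousLinearMap.coe_coe, sum_apply,
    one_apply_eq_self]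
  rw [Finset.sum_eq_single j]
  · exact Submodule.starProjection_eq_self_iff.mpr (Submodule.mem_span_singleton_self _)
  · intro i _ hij
    simp [Submodule.starProjection_singleton, ho hij]
  · simp

/-- A `0`-`1` assignment to the integer vectors in which exactly one vector of every orthogonal
basis is assigned the value `true`. -/
def IsOrthogonalColoring (f : (Fin 3 → ℤ) → Bool) : Prop :=
  ∀ u v w : Fin 3 → ℤ, u ≠ 0 → v ≠ 0 → w ≠ 0 →
    u ⬝ᵥ v = 0 → u ⬝ᵥ w = 0 → v ⬝ᵥ w = 0 →
    ((f u = true ∧ f v = false ∧ f w = false) ∨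
     (f u = false ∧ f v = true ∧ f w = false) ∨
     (f u = false ∧ f v = false ∧ f w = true))

namespace IsOrthogonalColoring

variable {f : (Fin 3 → ℤ) → Bool}

theorem comp (hf : IsOrthogonalColoring f) {L : (Fin 3 → ℤ) → Fin 3 → ℤ}
    (hL : ∀ u v, L u ⬝ᵥ L v = u ⬝ᵥ v) : IsOrthogonalColoring (f ∘ L) := by
  have hL₀ {u : Fin 3 → ℤ} (hu : u ≠ 0) : L u ≠ 0 := by
    rwa [Ne, ← dotProduct_self_eq_zero, hL, dotProduct_self_eq_zero]
  intro u v w hu hv hw huv huw hvw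
  exact hf _ _ _ (hL₀ hu) (hL₀ hv) (hL₀ hw) (by rwa [hL]) (by rwa [hL]) (by rwa [hL])

theorem eq_false_of_orthogonal (hf : IsOrthogonalColoring f) {u v : Fin 3 → ℤ}
    (hfu : f u = true) (hu : u ≠ 0) (hv : v ≠ 0) (huv : u ⬝ᵥ v = 0) : f v = false := by
  have hw : u ⨯₃ v ≠ 0 := by
    intro h
    have := cross_dot_cross u v u v
    rw [h, huv, zero_mul, sub_zero, zero_dotProduct] at this
    exact mul_ne_zero (mt dotProduct_self_eq_zero.mp hu) (mt dotProduct_self_eq_zero.mp hv)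
      this.symm
  have := hf u v (u ⨯₃ v) hu hv hw huv (dot_self_cross u v) (dot_cross_self u v)
  grind

theorem eq_true_of_orthogonal (hf : IsOrthogonalColoring f) {u v w : Fin 3 → ℤ}
    (hfu : f u = false) (hfv : f v = false) (hu : u ≠ 0) (hv : v ≠ 0) (hw : w ≠ 0)
    (huv : u ⬝ᵥ v = 0) (huw : u ⬝ᵥ w = 0) (hvw : v ⬝ᵥ w = 0) : f w = true := by
  have := hf u v w hu hv hw huv huw hvw
  grind

theorem apply_one_zero_neg_one (hf : IsOrthogonalColoring f)
    (hz : f ![0, 0, 1] = true) (hyz : f ![0, 1, 1] = true) : f ![1, 0, -1] = false := by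
  have h₁ : f ![1, -1, 0] = false :=
    hf.eq_false_of_orthogonal hz (by decide) (by decide) (by decide)
  have h₂ : f ![0, 1, 0] = false :=
    hf.eq_false_of_orthogonal hz (by decide) (by decide) (by decide)
  have h₃ : f ![1, 1, -1] = false :=
    hf.eq_false_of_orthogonal hyz (by decide) (by decide) (by decide)
  have h₄ : f ![1, 2, -2] = false :=
    hf.eq_false_of_orthogonal hyz (by decide) (by decide) (by decide)
  have h₅ : f ![1, 1, 2] = true :=
    hf.eq_true_of_orthogonal h₁ h₃ (by decide) (by decide) (by decide)
      (by decide) (by decide) (by decide)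
  have h₆ : f ![2, 0, -1] = false :=
    hf.eq_false_of_orthogonal h₅ (by decide) (by decide) (by decide)
  have h₇ : f ![1, 0, 2] = true :=
    hf.eq_true_of_orthogonal h₂ h₆ (by decide) (by decide) (by decide)
      (by decide) (by decide) (by decide)
  have h₈ : f ![2, -2, -1] = false :=
    hf.eq_false_of_orthogonal h₇ (by decide) (by decide) (by decide)
  have h₉ : f ![2, 1, 2] = true :=
    hf.eq_true_of_orthogonal h₄ h₈ (by decide) (by decide) (by decide)
      (by decide) (by decide) (by decide)
  exact hf.eq_false_of_orthogonal h₉ (by decide) (by decide) (by decide)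

theorem apply_zero_one_one (hf : IsOrthogonalColoring f) (hz : f ![0, 0, 1] = true) :
    f ![0, 1, 1] = false := by
  by_contra hyz
  rw [Bool.not_eq_false] at hyz
  have h₁ : f ![1, 0, -1] = false := hf.apply_one_zero_neg_one hz hyz
  have h₂ : f ![-1, 0, -1] = false := by
    have := (hf.comp (L := fun u => ![-u 0, u 1, u 2])
      (by simp [Matrix.vec3_dotProduct, add_assoc])).apply_one_zero_neg_one
    simpa using this hz hyz
  have h₃ : f ![0, 1, 0] = true :=
    hf.eq_true_of_orthogonal h₁ h₂ (by decide) (by decide) (by decide)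
      (by decide) (by decide) (by decide)
  have h₄ : f ![0, 1, 0] = false :=
    hf.eq_false_of_orthogonal hz (by decide) (by decide) (by decide)
  simp [h₃] at h₄

theorem apply_zero_zero_one (hf : IsOrthogonalColoring f) : f ![0, 0, 1] = false := by
  by_contra hz
  rw [Bool.not_eq_false] at hz
  have h₁ : f ![0, 1, 1] = false := hf.apply_zero_one_one hz
  have h₂ : f ![0, -1, 1] = false := by
    have := (hf.comp (L := fun u => ![u 0, -u 1, u 2])
      (by simp [Matrix.vec3_dotProduct, add_assoc])).apply_zero_one_one
    simpa using this (by simpa using hz)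
  have h₃ : f ![1, 0, 0] = true :=
    hf.eq_true_of_orthogonal h₁ h₂ (by decide) (by decide) (by decide)
      (by decide) (by decide) (by decide)
  have h₄ : f ![1, 0, 0] = false :=
    hf.eq_false_of_orthogonal hz (by decide) (by decide) (by decide)
  simp [h₃] at h₄

end IsOrthogonalColoring

/-- The integer vectors of dimension three admit no orthogonal coloring. -/
theorem not_isOrthogonalColoring (f : (Fin 3 → ℤ) → Bool) : ¬ IsOrthogonalColoring f := by
  intro hf
  have hz : f ![0, 0, 1] = false := hf.apply_zero_zero_one
  have hy : f ![0, 1, 0] = false := by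
    have := (hf.comp (L := fun u => ![u 0, u 2, u 1])
      (by intro u v; simp [Matrix.vec3_dotProduct]; ring)).apply_zero_zero_one
    simpa using this
  have hx : f ![1, 0, 0] = false := by
    have := (hf.comp (L := fun u => ![u 2, u 1, u 0])
      (by intro u v; simp [Matrix.vec3_dotProduct]; ring)).apply_zero_zero_one
    simpa using this
  have := hf.eq_true_of_orthogonal (w := ![1, 0, 0]) hz hy (by decide) (by decide) (by decide)
    (by decide) (by decide) (by decide)
  simp [hx] at this

/-- An integer vector, regarded as an element of `ℂ³`. -/
noncomputable def intVec (u : Fin 3 → ℤ) : EuclideanSpace ℂ (Fin 3) :=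
  WithLp.toLp 2 fun i => (u i : ℂ)

theorem intVec_ne_zero {u : Fin 3 → ℤ} (hu : u ≠ 0) : intVec u ≠ 0 := by
  contrapose! hu
  ext i
  simpa [intVec] using congrArg (· i) hu

theorem inner_intVec (u v : Fin 3 → ℤ) : inner ℂ (intVec u) (intVec v) = ((u ⬝ᵥ v : ℤ) : ℂ) := by
  simp [intVec, PiLp.inner_apply, dotProduct, mul_comm]

/-- The orthogonal projection onto the line spanned by an integer vector. -/
noncomputable def intProj (u : Fin 3 → ℤ) :
    EuclideanSpace ℂ (Fin 3) →L[ℂ] EuclideanSpace ℂ (Fin 3) :=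
  (ℂ ∙ intVec u).starProjection

theorem finrank_range_intProj {u : Fin 3 → ℤ} (hu : u ≠ 0) :
    Module.finrank ℂ (LinearMap.range (intProj u).toLinearMap) = 1 := by
  rw [intProj, Submodule.range_starProjection]
  exact finrank_span_singleton (intVec_ne_zero hu)

theorem intProj_mul_eq_zero {u v : Fin 3 → ℤ} (huv : u ⬝ᵥ v = 0) :
    intProj u * intProj v = 0 := by
  refine Submodule.IsOrtho.starProjection_comp_starProjection ?_
  rw [Submodule.isOrtho_span]
  simp [inner_intVec, huv]

theorem intProj_add_eq_one {u v w : Fin 3 → ℤ} (hu : u ≠ 0) (hv : v ≠ 0) (hw : w ≠ 0)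
    (huv : u ⬝ᵥ v = 0) (huw : u ⬝ᵥ w = 0) (hvw : v ⬝ᵥ w = 0) :
    intProj u + intProj v + intProj w = 1 := by
  have := sum_starProjection_span_singleton_eq_one (𝕜 := ℂ)
    (v := ![intVec u, intVec v, intVec w])
    (by simp [Fin.forall_fin_succ, intVec_ne_zero, hu, hv, hw])
    (by
      intro i j hij
      fin_cases i <;> fin_cases j <;>
        simp_all [inner_intVec, dotProduct_comm v u, dotProduct_comm w u, dotProduct_comm w v])
    (by simp)
  simpa [Fin.sum_univ_three, intProj] using this

theorem kochen_specker_dim3 :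
    ¬ ∃ v : (EuclideanSpace ℂ (Fin 3) →L[ℂ] EuclideanSpace ℂ (Fin 3)) → Bool,
      ∀ p₁ p₂ p₃ : EuclideanSpace ℂ (Fin 3) →L[ℂ] EuclideanSpace ℂ (Fin 3),
        IsSelfAdjoint p₁ → IsIdempotentElem p₁ →
          Module.finrank ℂ (LinearMap.range p₁.toLinearMap) = 1 →
        IsSelfAdjoint p₂ → IsIdempotentElem p₂ →
          Module.finrank ℂ (LinearMap.range p₂.toLinearMap) = 1 →
        IsSelfAdjoint p₃ → IsIdempotentElem p₃ →
          Module.finrank ℂ (LinearMap.range p₃.toLinearMap) = 1 →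
        p₁ * p₂ = 0 → p₁ * p₃ = 0 → p₂ * p₃ = 0 →
        p₁ + p₂ + p₃ = 1 →
        ((v p₁ = true ∧ v p₂ = false ∧ v p₃ = false) ∨
         (v p₁ = false ∧ v p₂ = true ∧ v p₃ = false) ∨
         (v p₁ = false ∧ v p₂ = false ∧ v p₃ = true)) := by
  rintro ⟨v, hv⟩
  refine not_isOrthogonalColoring (v ∘ intProj) fun a b c ha hb hc hab hac hbc => ?_
  have hsa (u) : IsSelfAdjoint (intProj u) := isSelfAdjoint_starProjection _
  have hid (u) : IsIdempotentElem (intProj u) := Submodule.isIdempotentElem_starProjection _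
  exact hv _ _ _ (hsa a) (hid a) (finrank_range_intProj ha) (hsa b) (hid b)
    (finrank_range_intProj hb) (hsa c) (hid c) (finrank_range_intProj hc)
    (intProj_mul_eq_zero hab) (intProj_mul_eq_zero hac) (intProj_mul_eq_zero hbc)
    (intProj_add_eq_one ha hb hc hab hac hbc)
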